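/- The polynomial function F on ℝ⁷ satisfies F ∘ U = F, F ∘ Q = F, F ∘ S = F and F ∘ P = F; moreover F(Π₃(t₁,t₂,t₃)) = 0 for all (t₁,t₂,t₃) ∈ ℝ³. -/

import Mathlib

open Real

noncomputable section

/-- Coordinates on `ℝ⁷` are `(x₁,x₂,x₃,x₁₂,x₁₃,x₂₃,x₁₂₃)`, indexed `0,…,6`. -/
abbrev R7 := Fin 7 → ℝ

/-- The Aut(F₃)-invariant polynomial `F`. -/
def F (p : R7) : ℝ :=
  p 0 ^ 2 + p 1 ^ 2 + p 2 ^ 2 + p 3 ^ 2 + p 4 ^ 2 + p 5 ^ 2 + p 6 ^ 2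
    + 4 * p 0 * p 1 * p 2 * p 6
    - 2 * p 0 * p 1 * p 3 - 2 * p 0 * p 2 * p 4 - 2 * p 0 * p 5 * p 6
    - 2 * p 1 * p 2 * p 5 - 2 * p 1 * p 4 * p 6 - 2 * p 2 * p 3 * p 6
    + 2 * p 3 * p 4 * p 5 - 1

def U (p : R7) : R7 :=
  ![p 3, p 1, p 2, 2 * p 1 * p 3 - p 0, p 6, p 5, 2 * p 1 * p 6 - p 4]

def Q (p : R7) : R7 :=
  ![p 1, p 2, p 0, p 5, p 3, p 4, p 6]

def S (p : R7) : R7 :=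
  ![p 0, p 1, p 2, 2 * p 0 * p 1 - p 3, 2 * p 0 * p 2 - p 4, p 5,
    2 * p 0 * p 5 - p 6]

def P (p : R7) : R7 :=
  ![p 1, p 0, p 2, p 3, p 5, p 4,
    -4 * p 0 * p 1 * p 2 + 2 * p 0 * p 5 + 2 * p 1 * p 4 + 2 * p 2 * p 3 - p 6]

/-- `Π₃(t₁,t₂,t₃)`. -/
def Pi3 (t₁ t₂ t₃ : ℝ) : R7 :=
  ![Real.cos (2 * π * t₁), Real.cos (2 * π * t₂), Real.cos (2 * π * t₃),
    Real.cos (2 * π * (t₁ + t₂)), Real.cos (2 * π * (t₁ + t₃)),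
    Real.cos (2 * π * (t₂ + t₃)), Real.cos (2 * π * (t₁ + t₂ + t₃))]

theorem stmt8 :
    (∀ p : R7, F (U p) = F p) ∧ (∀ p : R7, F (Q p) = F p) ∧
    (∀ p : R7, F (S p) = F p) ∧ (∀ p : R7, F (P p) = F p) ∧
    (∀ t₁ t₂ t₃ : ℝ, F (Pi3 t₁ t₂ t₃) = 0) := by
  refine ⟨?_, ?_, ?_, ?_, ?_⟩
  · intro p
    simp [F, U]
    ring
  · intro p
    simp [F, Q]
    ring
  · intro p
    simp [F, S]
    ring
  · intro p
    simp [F, P]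
    ring
  · intro t₁ t₂ t₃
    simp only [F, Pi3, mul_add, Real.cos_add, Real.sin_add]
    have h1 := Real.sin_sq_add_cos_sq (2 * π * t₁)
    have h2 := Real.sin_sq_add_cos_sq (2 * π * t₂)
    have h3 := Real.sin_sq_add_cos_sq (2 * π * t₃)
    simp
    generalize Real.sin (2 * π * t₁) = a at *
    generalize Real.cos (2 * π * t₁) = x at *
    generalize Real.sin (2 * π * t₂) = b at *
    generalize Real.cos (2 * π * t₂) = y at *
    generalize Real.sin (2 * π * t₃) = c at *
    generalize Real.cos (2 * π * t₃) = z at *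
    grind

end
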